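/- Let q be an indeterminate and, for t₅ ∈ ℂ, let M₅(t₅) be the 6×6 matrix over the polynomial ring ℂ[q] with rows (0, 0, 0, 0, 4q, 0), (4, t₅q, 0, 0, 0, 4q), (0, 4, 0, t₅q, 0, 0), (0, 4, t₅q, 0, 0, 0), (0, 0, 4, 4, t₅q, 0), (−3t₅, 0, 0, 0, 4, 0). Let Δ(t₅) ∈ ℂ[q] be the resultant of the characteristic polynomial of M₅(t₅) with its derivative. Then for every t₅ ∈ ℂ, the coefficient of q^k in Δ(t₅) vanishes for all k ≤ 8, and the coefficient of q^9 equals 1888946593147858085478400·t₅². -/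

import Mathlib

/-- The resultant of two polynomials `p` and `q`, computed as the determinant of
the Sylvester matrix built with respect to the degree bounds `m` for `p` and
`n` for `q`. -/
noncomputable def sylvesterRes {R : Type*} [CommRing R] (m n : ℕ)
    (p q : Polynomial R) : R :=
  (Matrix.of (fun i j : Fin (m + n) =>
    if (i : ℕ) < n then
      (if (j : ℕ) ≤ m + (i : ℕ) then p.coeff (m + (i : ℕ) - (j : ℕ)) else 0)
    else
      (if (j : ℕ) ≤ ((i : ℕ) - n) + n then
        q.coeff (((i : ℕ) - n) + n - (j : ℕ)) else 0))).det

open Polynomial in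
/-- The energy-2 truncation of the Dubrovin operator of `Gr(2,4)` with bulk
parameter supported on the Schubert class `σ₍₂,₂₎`, as a matrix over `ℂ[q]`. -/
noncomputable def M5 (t : ℂ) : Matrix (Fin 6) (Fin 6) (Polynomial ℂ) :=
  !![0,            0,       0,       0,       4 * X,   0;
     4,            C t * X, 0,       0,       0,       4 * X;
     0,            4,       0,       C t * X, 0,       0;
     0,            4,       C t * X, 0,       0,       0;
     0,            0,       4,       4,       C t * X, 0;
     C (-3 * t),   0,       0,       0,       4,       0]

open Polynomial

theorem sylvesterRes_eq_resultant {R : Type*} [CommRing R] (m n : ℕ) (p q : R[X])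
    (hp : p.natDegree ≤ m) (hq : q.natDegree ≤ n) :
    sylvesterRes m n p q = resultant p q m n := by
  rw [sylvesterRes, resultant, ← Matrix.det_transpose,
    ← Matrix.det_submatrix_equiv_self Fin.revPerm]
  congr 1
  ext i j
  simp only [Matrix.submatrix_apply, Matrix.transpose_apply, Matrix.of_apply, Fin.revPerm_apply,
    sylvester, Fin.val_rev, Set.mem_Icc]
  induction j using Fin.addCases with
  | left k =>
    have := k.2
    have := i.2
    simp only [Fin.addCases_left, Fin.val_castAdd]
    rw [if_neg (by lia)]
    split_ifs
    · congr 1; lia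
    · exact coeff_eq_zero_of_natDegree_lt (by lia)
    · lia
    · rfl
  | right k =>
    have := k.2
    have := i.2
    simp only [Fin.addCases_right, Fin.val_natAdd]
    rw [if_pos (by lia)]
    split_ifs
    · congr 1; lia
    · exact coeff_eq_zero_of_natDegree_lt (by lia)
    · lia
    · rfl

set_option maxHeartbeats 1000000 in
theorem det_dubrovin_charmatrix {R : Type*} [CommRing R] (x q t : R) :
    Matrix.det !![x, 0, 0, 0, -(4 * q), 0;
                  -4, x - t * q, 0, 0, 0, -(4 * q);
                  0, -4, x, -(t * q), 0, 0;
                  0, -4, -(t * q), x, 0, 0;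
                  0, 0, -4, -4, x - t * q, 0;
                  3 * t, 0, 0, 0, -4, x] =
      (x + t * q) * (x ^ 2 * (x - t * q) ^ 3 - 512 * q * (2 * x - 3 * (t * q))) := by
  simp [Matrix.det_succ_row_zero, Fin.sum_univ_succ, Fin.succAbove]
  ring

theorem charpoly_M5 (t : ℂ) :
    (M5 t).charpoly = (X + C (C t * X)) *
      (X ^ 2 * (X - C (C t * X)) ^ 3 - C (512 * X) * (2 * X - 3 * C (C t * X))) := by
  have h := det_dubrovin_charmatrix (X : ℂ[X][X]) (C X) (C (C t))
  simp only [C_mul, show C (512 : ℂ[X]) = 512 from rfl]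
  rw [← h, Matrix.charpoly]
  congr 1
  ext1 i j
  fin_cases i <;> fin_cases j <;>
    simp [Matrix.charmatrix, M5, show C (4 : ℂ[X]) = 4 from rfl, show C (3 : ℂ[X]) = 3 from rfl,
      show C (3 : ℂ) = 3 from rfl]

section

variable {R : Type*} [CommRing R] (a c : R)

/-- With `a = t q` and `c = 512 q`, the quintic factor of the characteristic polynomial of `M5`. -/
noncomputable def quinticFactor : R[X] :=
  X ^ 2 * (X - C a) ^ 3 - C c * (2 * X - 3 * C a)

theorem quinticFactor_eq : quinticFactor a c =
    X ^ 5 + C (-3 * a) * X ^ 4 + C (3 * a ^ 2) * X ^ 3 + C (-a ^ 3) * X ^ 2 + C (-2 * c) * X +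
      C (3 * a * c) := by
  simp only [quinticFactor, C_mul, C_neg, C_pow, show C (2 : R) = 2 from rfl,
    show C (3 : R) = 3 from rfl]
  ring

theorem derivative_quinticFactor_eq : derivative (quinticFactor a c) =
    C 5 * X ^ 4 + C (-12 * a) * X ^ 3 + C (9 * a ^ 2) * X ^ 2 + C (-2 * a ^ 3) * X +
      C (-2 * c) := by
  rw [quinticFactor_eq]
  simp only [derivative_add, derivative_C_mul, derivative_X_pow, derivative_X, derivative_C]
  simp only [C_mul, C_neg, C_pow, show C (2 : R) = 2 from rfl, show C (3 : R) = 3 from rfl,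
    show C (5 : R) = 5 from rfl, show C (9 : R) = 9 from rfl, show C (12 : R) = 12 from rfl]
  norm_num
  simp only [show C (4 : R) = 4 from rfl, show C (2 : R) = 2 from rfl,
    show C (3 : R) = 3 from rfl, show C (5 : R) = 5 from rfl]
  ring

theorem natDegree_quinticFactor [Nontrivial R] : (quinticFactor a c).natDegree = 5 := by
  rw [quinticFactor_eq]; compute_degree!

theorem natDegree_derivative_quinticFactor [CharZero R] :
    (derivative (quinticFactor a c)).natDegree = 4 := by
  rw [derivative_quinticFactor_eq]
  compute_degree!

theorem Matrix.det_fromBlocks_of_add_mul_eq_zero {m n : Type*} [Fintype m] [Fintype n]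
    [DecidableEq m] [DecidableEq n] (A : Matrix m m R) (B : Matrix m n R) (C : Matrix n m R)
    (D : Matrix n n R) (Q : Matrix n m R) (h : C + D * Q = 0) :
    (Matrix.fromBlocks A B C D).det = (A + B * Q).det * D.det := by
  have hQ : (Matrix.fromBlocks 1 0 Q 1 : Matrix (m ⊕ n) (m ⊕ n) R).det = 1 := by simp
  rw [← mul_one (Matrix.fromBlocks A B C D).det, ← hQ, ← Matrix.det_mul,
    Matrix.fromBlocks_multiply]
  simp [h]

set_option maxHeartbeats 1000000 in
theorem sylvester_five_four_submatrix (f g : R[X]) :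
    (sylvester f g 5 4).submatrix finSumFinEquiv finSumFinEquiv = Matrix.fromBlocks
      !![g.coeff 0, 0, 0, 0, 0;
         g.coeff 1, g.coeff 0, 0, 0, 0;
         g.coeff 2, g.coeff 1, g.coeff 0, 0, 0;
         g.coeff 3, g.coeff 2, g.coeff 1, g.coeff 0, 0;
         g.coeff 4, g.coeff 3, g.coeff 2, g.coeff 1, g.coeff 0]
      !![f.coeff 0, 0, 0, 0;
         f.coeff 1, f.coeff 0, 0, 0;
         f.coeff 2, f.coeff 1, f.coeff 0, 0;
         f.coeff 3, f.coeff 2, f.coeff 1, f.coeff 0;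
         f.coeff 4, f.coeff 3, f.coeff 2, f.coeff 1]
      !![0, g.coeff 4, g.coeff 3, g.coeff 2, g.coeff 1;
         0, 0, g.coeff 4, g.coeff 3, g.coeff 2;
         0, 0, 0, g.coeff 4, g.coeff 3;
         0, 0, 0, 0, g.coeff 4]
      !![f.coeff 5, f.coeff 4, f.coeff 3, f.coeff 2;
         0, f.coeff 5, f.coeff 4, f.coeff 3;
         0, 0, f.coeff 5, f.coeff 4;
         0, 0, 0, f.coeff 5] := by
  ext i j
  rcases i with i | i <;> rcases j with j | j <;>
    simp only [Matrix.submatrix_apply, finSumFinEquiv_apply_left, finSumFinEquiv_apply_right,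
      sylvester, Matrix.of_apply, Fin.addCases_left, Fin.addCases_right, Fin.val_castAdd,
      Fin.val_natAdd, Matrix.fromBlocks_apply₁₁, Matrix.fromBlocks_apply₁₂,
      Matrix.fromBlocks_apply₂₁, Matrix.fromBlocks_apply₂₂] <;>
    fin_cases i <;> fin_cases j <;> simp

/-- The determinant of multiplication by the derivative of `quinticFactor a c` modulo
`quinticFactor a c`. -/
theorem det_mul_derivative_quinticFactor : Matrix.det
    !![-2 * c, -15 * a * c, -9 * a ^ 2 * c, -9 * a ^ 3 * c, -9 * a ^ 4 * c;
       -2 * a ^ 3, 8 * c, -9 * a * c, -3 * a ^ 2 * c, -3 * a ^ 3 * c;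
       9 * a ^ 2, 3 * a ^ 3, 8 * c + 3 * a ^ 4, -9 * a * c + 3 * a ^ 5, -3 * a ^ 2 * c + 3 * a ^ 6;
       -12 * a, -6 * a ^ 2, -6 * a ^ 3, 8 * c - 6 * a ^ 4, -9 * a * c - 6 * a ^ 5;
       5, 3 * a, 3 * a ^ 2, 3 * a ^ 3, 8 * c + 3 * a ^ 4] =
    c ^ 3 * (-8192 * c ^ 2 + 20325 * a ^ 4 * c - 324 * a ^ 8) := by
  simp [Matrix.det_succ_row_zero, Fin.sum_univ_succ, Fin.succAbove]
  ring

set_option maxHeartbeats 1000000 in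
theorem resultant_quinticFactor_derivative :
    resultant (quinticFactor a c) (derivative (quinticFactor a c)) 5 4 =
      c ^ 3 * (-8192 * c ^ 2 + 20325 * a ^ 4 * c - 324 * a ^ 8) := by
  have hf (k : ℕ) : (quinticFactor a c).coeff k = if k = 5 then 1 else if k = 4 then -3 * a else
      if k = 3 then 3 * a ^ 2 else if k = 2 then -a ^ 3 else if k = 1 then -2 * c else
      if k = 0 then 3 * a * c else 0 := by
    rw [quinticFactor_eq]
    simp only [coeff_add, coeff_C_mul, coeff_X_pow, coeff_X, coeff_C]
    split_ifs <;> first | omega | simp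
  have hg (k : ℕ) : (derivative (quinticFactor a c)).coeff k = if k = 4 then 5 else
      if k = 3 then -12 * a else if k = 2 then 9 * a ^ 2 else if k = 1 then -2 * a ^ 3 else
      if k = 0 then -2 * c else 0 := by
    rw [derivative_quinticFactor_eq]
    simp only [coeff_add, coeff_C_mul, coeff_X_pow, coeff_X, coeff_C]
    split_ifs <;> first | omega | simp
  rw [resultant, ← Matrix.det_submatrix_equiv_self finSumFinEquiv, sylvester_five_four_submatrix,
    Matrix.det_fromBlocks_of_add_mul_eq_zero _ _ _ _
      !![0, -5, -3 * a, -3 * a ^ 2, -3 * a ^ 3;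
         0, 0, -5, -3 * a, -3 * a ^ 2;
         0, 0, 0, -5, -3 * a;
         0, 0, 0, 0, -5],
    ← det_mul_derivative_quinticFactor]
  · refine (congrArg₂ (· * ·) (congrArg Matrix.det ?_) ?_).trans (mul_one _)
    · ext i j
      fin_cases i <;> fin_cases j <;>
        simp [hf, hg] <;> ring
    · simp [hf, Matrix.det_succ_column_zero, Fin.sum_univ_succ]
  · ext i j
    fin_cases i <;> fin_cases j <;>
      simp [hf, hg] <;> ring

theorem resultant_linear_mul_quintic [IsDomain R] [CharZero R] :
    resultant ((X + C a) * quinticFactor a c) (derivative ((X + C a) * quinticFactor a c)) 6 5 =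
      -(5 * a * c - 8 * a ^ 5) ^ 2 *
        resultant (quinticFactor a c) (derivative (quinticFactor a c)) 5 4 := by
  set g := quinticFactor a c with hg
  have hg5 : g.natDegree = 5 := natDegree_quinticFactor a c
  have hg4 : (derivative g).natDegree = 4 := natDegree_derivative_quinticFactor a c
  have hl : (X + C a).natDegree = 1 := natDegree_X_add_C a
  have heval : eval (-a) g = 5 * a * c - 8 * a ^ 5 := by
    simp [hg, quinticFactor]
    ring
  have hd : derivative ((X + C a) * g) = (X + C a) * derivative g + g * 1 := by
    simp [derivative_mul]
    ring
  have hd5 : (derivative ((X + C a) * g)).natDegree ≤ 5 :=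
    (natDegree_derivative_le _).trans
      (Nat.sub_le_sub_right (m := 6) (natDegree_mul_le.trans (by rw [hl, hg5])) 1)
  have h₁ := resultant_mul_left (X + C a) g (derivative ((X + C a) * g)) 5 hd5
  have h₂ : resultant g ((X + C a) * derivative g) 5 5 =
      -(5 * a * c - 8 * a ^ 5) * resultant g (derivative g) 5 4 := by
    have h := resultant_mul_right g (X + C a) (derivative g) 5 hg5.le
    rw [hl, hg4, resultant_X_add_C_right _ _ _ hg5.le, heval] at h
    rw [show (5 : ℕ) = 1 + 4 from rfl] at h ⊢
    rw [h]
    ring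
  rw [hl, hg5, resultant_X_add_C_left _ _ _ hd5] at h₁
  refine h₁.trans ?_
  rw [hd, resultant_add_mul_right _ _ _ _ _ (by simp) hg5.le, h₂]
  simp [heval]
  ring

end

/-- The discriminant of `M5 t` vanishes to order `9` in `q`, with leading
coefficient `1888946593147858085478400 · t₅²`. -/
theorem discrim_M5 (t : ℂ) :
    (∀ k : ℕ, k ≤ 8 →
      (sylvesterRes 6 5 (M5 t).charpoly (M5 t).charpoly.derivative).coeff k = 0) ∧
    (sylvesterRes 6 5 (M5 t).charpoly (M5 t).charpoly.derivative).coeff 9 =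
      1888946593147858085478400 * t ^ 2 := by
  have hdeg : (M5 t).charpoly.natDegree = 6 := by
    simp [Matrix.charpoly_natDegree_eq_dim]
  rw [sylvesterRes_eq_resultant 6 5 _ _ hdeg.le
    ((natDegree_derivative_le _).trans (by rw [hdeg])), charpoly_M5]
  change (∀ k : ℕ, k ≤ 8 → (resultant ((X + C (C t * X)) * quinticFactor (C t * X) (512 * X))
    (derivative ((X + C (C t * X)) * quinticFactor (C t * X) (512 * X))) 6 5).coeff k = 0) ∧
    (resultant ((X + C (C t * X)) * quinticFactor (C t * X) (512 * X))
    (derivative ((X + C (C t * X)) * quinticFactor (C t * X) (512 * X))) 6 5).coeff 9 = _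
  rw [resultant_linear_mul_quintic, resultant_quinticFactor_derivative]
  obtain ⟨r, hr⟩ : ∃ r : ℂ[X], -(5 * (C t * X) * (512 * X) - 8 * (C t * X) ^ 5) ^ 2 *
      ((512 * X) ^ 3 * (-8192 * (512 * X) ^ 2 + 20325 * (C t * X) ^ 4 * (512 * X) -
        324 * (C t * X) ^ 8)) =
      (C (1888946593147858085478400 * t ^ 2) + X * r) * X ^ 9 := by
    refine ⟨-(C t ^ 2) * 512 ^ 3 *
      (2560 ^ 2 * (20325 * 512 * C t ^ 4 * X ^ 2 - 324 * C t ^ 8 * X ^ 5) +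
        (-2 * 2560 * 8 * C t ^ 4 * X ^ 2 + 64 * C t ^ 8 * X ^ 5) *
          (-8192 * 512 ^ 2 + 20325 * 512 * C t ^ 4 * X ^ 3 - 324 * C t ^ 8 * X ^ 6)), ?_⟩
    rw [C_mul, C_pow, show C (1888946593147858085478400 : ℂ) = 1888946593147858085478400 from rfl]
    ring
  rw [hr]
  constructor
  · intro k hk
    rw [coeff_mul_X_pow', if_neg (by lia)]
  · rw [coeff_mul_X_pow']
    simp [coeff_zero_eq_eval_zero]
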